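/- arXiv:2206.11780 — 2 statements merged into one kernel-verified Lean document; each statement's English description precedes it below -/
import Mathlib

section
/- (Per-step robustness inequality for Interp.) Let X be a real normed vector space, k ≥ 1 a radial Lipschitz bound for X, γ > 0, and f : X → ℝ a convex function with f ≥ 0 everywhere. Let s′, s, x̃′, x̃ ∈ X and let x′ lie on the segment [s′, x̃′]. Set Δ = f(x̃) + ‖x̃ − x̃′‖ and define y = s′ + ρ(x̃ − s′; ‖x′ − s′‖), z = s′ + ρ(y − s′; max(‖y − s′‖ − γ·Δ, 0)), and x = s + ρ(x̃ − s; ‖z − s′‖). Then, with c = 1 + k/γ, one has f(x) + ‖x − x′‖ + c·‖x − s‖ ≤ f(s) + ‖s − s′‖ + c·‖x′ − s′‖. -/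
/-- The radial retraction onto the closed ball of radius `r`. -/
noncomputable def radial {X : Type*} [NormedAddCommGroup X] [NormedSpace ℝ X]
    (v : X) (r : ℝ) : X :=
  if ‖v‖ ≤ r then v else (r / ‖v‖) • v

/-- `k` is a radial Lipschitz bound for `X`. -/
def RadialLipBound (X : Type*) [NormedAddCommGroup X] [NormedSpace ℝ X] (k : ℝ) : Prop :=
  ∀ u v : X, ∀ r : ℝ, 0 < r → ‖radial u r - radial v r‖ ≤ k * ‖u - v‖

section Radial

variable {X : Type*} [NormedAddCommGroup X] [NormedSpace ℝ X]

theorem radial_of_norm_le {v : X} {r : ℝ} (h : ‖v‖ ≤ r) : radial v r = v := if_pos h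

theorem radial_of_lt_norm {v : X} {r : ℝ} (h : r < ‖v‖) : radial v r = (r / ‖v‖) • v :=
  if_neg h.not_ge

theorem radial_zero_right (v : X) : radial v 0 = 0 := by
  unfold radial
  split_ifs with h
  · exact norm_le_zero_iff.mp h
  · simp

theorem norm_radial (v : X) {r : ℝ} (hr : 0 ≤ r) : ‖radial v r‖ = min ‖v‖ r := by
  rcases le_or_gt ‖v‖ r with h | h
  · rw [radial_of_norm_le h, min_eq_left h]
  · have hv : 0 < ‖v‖ := hr.trans_lt h
    rw [radial_of_lt_norm h, min_eq_right h.le, norm_smul, Real.norm_of_nonneg (by positivity),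
      div_mul_cancel₀ _ hv.ne']

theorem exists_radial_eq_smul (v : X) {r : ℝ} (hr : 0 ≤ r) :
    ∃ t ∈ Set.Icc (0 : ℝ) 1, radial v r = t • v := by
  rcases le_or_gt ‖v‖ r with h | h
  · exact ⟨1, by simp, by rw [radial_of_norm_le h, one_smul]⟩
  · exact ⟨r / ‖v‖, ⟨by positivity, div_le_one_of_le₀ h.le (norm_nonneg v)⟩, radial_of_lt_norm h⟩

theorem norm_sub_radial (v : X) {r : ℝ} (hr : 0 ≤ r) : ‖v - radial v r‖ = ‖v‖ - min ‖v‖ r := by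
  obtain ⟨t, ht, h⟩ := exists_radial_eq_smul v hr
  have hn := norm_radial v hr
  rw [h, norm_smul, Real.norm_of_nonneg ht.1] at hn
  rw [h, ← hn]
  nth_rewrite 1 [← one_smul ℝ v]
  rw [← sub_smul, norm_smul, Real.norm_of_nonneg (sub_nonneg.mpr ht.2)]
  ring

theorem radial_radial (v : X) {r R : ℝ} (hr : 0 ≤ r) (hrR : r ≤ R) :
    radial (radial v R) r = radial v r := by
  rcases le_or_gt ‖v‖ R with h | h
  · rw [radial_of_norm_le h]
  · have hn : ‖radial v R‖ = R := by rw [norm_radial v (hr.trans hrR), min_eq_right h.le]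
    rcases hrR.eq_or_lt with rfl | hlt
    · exact radial_of_norm_le hn.le
    · have hR : R ≠ 0 := (hr.trans_lt hlt).ne'
      rw [radial_of_lt_norm (hn.symm ▸ hlt), hn, radial_of_lt_norm h, radial_of_lt_norm (hlt.trans h),
        smul_smul]
      congr 1
      field_simp

theorem radial_norm_smul (v : X) {l : ℝ} (hl : l ∈ Set.Icc (0 : ℝ) 1) :
    radial v ‖l • v‖ = l • v := by
  rw [norm_smul, Real.norm_of_nonneg hl.1]
  rcases le_or_gt ‖v‖ (l * ‖v‖) with h | h
  · rw [radial_of_norm_le h]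
    rcases hl.2.eq_or_lt with rfl | hl1
    · rw [one_smul]
    · have hv : v = 0 := norm_le_zero_iff.mp (by nlinarith [norm_nonneg v])
      simp [hv]
  · have hv : ‖v‖ ≠ 0 := by
      intro h0
      simp [h0] at h
    rw [radial_of_lt_norm h, mul_div_cancel_right₀ _ hv]

/-- Moving two points towards `p` by the same distance, stopping at `p`, does not increase the
distance between them. -/
theorem norm_add_radial_sub_add_radial_le (p s s' : X) {r : ℝ} (hr : 0 ≤ r) :
    ‖(s + radial (p - s) r) - (s' + radial (p - s') r)‖ ≤ ‖s - s'‖ := by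
  have hab : |‖p - s'‖ - ‖p - s‖| ≤ ‖s - s'‖ := by
    simpa using abs_norm_sub_norm_le (p - s') (p - s)
  obtain ⟨h₁, h₂⟩ := abs_le.mp hab
  rcases le_or_gt ‖p - s‖ r with hs | hs
  · rw [radial_of_norm_le hs, add_sub_cancel, ← sub_sub, norm_sub_radial _ hr]
    rcases le_total ‖p - s'‖ r with h | h
    · simp [h]
    · rw [min_eq_right h]
      linarith
  · rcases le_or_gt ‖p - s'‖ r with h | h
    · rw [radial_of_norm_le h, add_sub_cancel, norm_sub_rev, ← sub_sub, norm_sub_radial _ hr,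
        min_eq_right hs.le]
      linarith
    · have hb : 0 < ‖p - s‖ := hr.trans_lt hs
      have ha : 0 < ‖p - s'‖ := hr.trans_lt h
      rw [radial_of_lt_norm hs, radial_of_lt_norm h]
      set t := r / ‖p - s‖
      set u := r / ‖p - s'‖
      have ht0 : 0 ≤ t := by positivity
      have ht1 : t ≤ 1 := div_le_one_of_le₀ hs.le hb.le
      have htb : t * ‖p - s‖ = r := div_mul_cancel₀ _ hb.ne'
      have hua : u * ‖p - s'‖ = r := div_mul_cancel₀ _ ha.ne'
      have hdecomp : (s + t • (p - s)) - (s' + u • (p - s')) =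
          (1 - t) • (s - s') + (t - u) • (p - s') := by module
      have hcoef : |t - u| * ‖p - s'‖ ≤ t * ‖s - s'‖ := by
        rw [← abs_of_pos ha, ← abs_mul,
          show (t - u) * ‖p - s'‖ = t * (‖p - s'‖ - ‖p - s‖) by linarith, abs_mul,
          abs_of_nonneg ht0]
        exact mul_le_mul_of_nonneg_left hab ht0
      rw [hdecomp]
      calc _ ≤ (1 - t) * ‖s - s'‖ + |t - u| * ‖p - s'‖ := by
            refine (norm_add_le _ _).trans_eq ?_
            rw [norm_smul, norm_smul, Real.norm_of_nonneg (sub_nonneg.mpr ht1), Real.norm_eq_abs]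
        _ ≤ ‖s - s'‖ := by linarith

/-- When moving towards `p`, a nonnegative convex function grows by at most its value at `p`. -/
theorem ConvexOn.add_radial_le {f : X → ℝ} (hf : ConvexOn ℝ Set.univ f) (hnn : ∀ p, 0 ≤ f p)
    (s p : X) {r : ℝ} (hr : 0 ≤ r) : f (s + radial (p - s) r) ≤ f s + f p := by
  obtain ⟨t, ht, h⟩ := exists_radial_eq_smul (p - s) hr
  have hc := hf.2 (Set.mem_univ s) (Set.mem_univ p) (sub_nonneg.mpr ht.2) ht.1 (by ring)
  rw [h, show s + t • (p - s) = (1 - t) • s + t • p by module]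
  simp only [smul_eq_mul] at hc
  nlinarith [hnn s, hnn p, ht.1, ht.2]

end Radial

/-- **Per-step robustness inequality for Interp.**
With `k ≥ 1` a radial Lipschitz bound, `γ > 0`, `f` convex and nonnegative, `x'` on
the segment `[s', adv']`, `Δ = f(adv) + ‖adv − adv'‖`,
`y = s' + ρ(adv − s'; ‖x' − s'‖)`, `z = s' + ρ(y − s'; max(‖y − s'‖ − γΔ, 0))`,
`x = s + ρ(adv − s; ‖z − s'‖)`, and `c = 1 + k/γ`, one has
`f(x) + ‖x − x'‖ + c·‖x − s‖ ≤ f(s) + ‖s − s'‖ + c·‖x' − s'‖`. -/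
theorem interp_step_robustness
    {X : Type*} [NormedAddCommGroup X] [NormedSpace ℝ X]
    (k : ℝ) (hk1 : 1 ≤ k) (hlip : RadialLipBound X k)
    (γ : ℝ) (hγ : 0 < γ)
    (f : X → ℝ) (hconv : ConvexOn ℝ Set.univ f) (hnn : ∀ p : X, 0 ≤ f p)
    (s' s adv' adv x' : X)
    (hx' : ∃ l : ℝ, l ∈ Set.Icc (0 : ℝ) 1 ∧ x' = l • adv' + (1 - l) • s')
    (Δ : ℝ) (hΔ : Δ = f adv + ‖adv - adv'‖)
    (y z x : X)
    (hy : y = s' + radial (adv - s') ‖x' - s'‖)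
    (hz : z = s' + radial (y - s') (max (‖y - s'‖ - γ * Δ) 0))
    (hx : x = s + radial (adv - s) ‖z - s'‖) :
    f x + ‖x - x'‖ + (1 + k / γ) * ‖x - s‖ ≤
      f s + ‖s - s'‖ + (1 + k / γ) * ‖x' - s'‖ := by
  obtain ⟨l, hl, hx'⟩ := hx'
  have hw : x' - s' = l • (adv' - s') := by rw [hx']; module
  have hc : 1 ≤ 1 + k / γ := by
    have : 0 ≤ k / γ := by positivity
    linarith
  have hΔ0 : 0 ≤ Δ := hΔ ▸ add_nonneg (hnn _) (norm_nonneg _)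
  have hR0 := norm_nonneg (x' - s')
  have hys : ‖y - s'‖ = min ‖adv - s'‖ ‖x' - s'‖ := by
    rw [hy, add_sub_cancel_left, norm_radial _ hR0]
  have hyR : ‖y - s'‖ ≤ ‖x' - s'‖ := hys ▸ min_le_right _ _
  have hr0 := le_max_right (‖y - s'‖ - γ * Δ) 0
  have hry : max (‖y - s'‖ - γ * Δ) 0 ≤ ‖y - s'‖ :=
    max_le (sub_le_self _ (by positivity)) (norm_nonneg _)
  have hzs : ‖z - s'‖ = max (‖y - s'‖ - γ * Δ) 0 := by
    rw [hz, add_sub_cancel_left, norm_radial _ hr0, min_eq_right hry]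
  rcases le_or_gt (‖y - s'‖ - γ * Δ) 0 with hr | hr
  · have hxs : x = s := by rw [hx, hzs, max_eq_right hr, radial_zero_right, add_zero]
    have htri := norm_sub_le_norm_sub_add_norm_sub s s' x'
    rw [norm_sub_rev s' x'] at htri
    rw [hxs, sub_self, norm_zero]
    nlinarith
  · rw [max_eq_left hr.le] at hzs hz hr0 hry
    have hRpos : 0 < ‖x' - s'‖ := hr.trans_le (hry.trans hyR)
    have hzadv : z = s' + radial (adv - s') ‖z - s'‖ := by
      rw [hzs, ← radial_radial (adv - s') hr.le (hry.trans hyR), ← add_sub_cancel_left s'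
        (radial (adv - s') ‖x' - s'‖), ← hy]
      exact hz
    have hxz : ‖x - z‖ ≤ ‖s - s'‖ := by
      rw [hx]
      nth_rewrite 2 [hzadv]
      exact norm_add_radial_sub_add_radial_le adv s s' (norm_nonneg _)
    have hzy : ‖z - y‖ = γ * Δ := by
      rw [norm_sub_rev, hz, ← sub_sub, norm_sub_radial _ hr.le, min_eq_right hry]
      ring
    have hyx : ‖y - x'‖ ≤ k * ‖adv - adv'‖ := by
      have h := hlip (adv - s') (adv' - s') ‖x' - s'‖ hRpos
      have hρ : radial (adv' - s') ‖x' - s'‖ = x' - s' := by rw [hw, radial_norm_smul _ hl]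
      rw [hρ, sub_sub_sub_cancel_right] at h
      rwa [hy, show s' + radial (adv - s') ‖x' - s'‖ - x' =
        radial (adv - s') ‖x' - s'‖ - (x' - s') by abel]
    have hxx : ‖x - x'‖ ≤ ‖x - z‖ + ‖z - y‖ + ‖y - x'‖ := by
      have h₁ := norm_sub_le_norm_sub_add_norm_sub x z x'
      have h₂ := norm_sub_le_norm_sub_add_norm_sub z y x'
      linarith
    have hfx : f x ≤ f s + f adv := hx ▸ hconv.add_radial_le hnn s adv (norm_nonneg _)
    have hxs : ‖x - s‖ ≤ ‖x' - s'‖ - γ * Δ := by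
      rw [hx, add_sub_cancel_left, norm_radial _ (norm_nonneg _)]
      refine (min_le_right _ _).trans ?_
      linarith
    have hcxs := mul_le_mul_of_nonneg_left hxs (zero_le_one.trans hc)
    have hcΔ : (1 + k / γ) * (γ * Δ) = γ * Δ + k * f adv + k * ‖adv - adv'‖ := by
      rw [hΔ]
      field_simp
      ring
    have hkf : f adv ≤ k * f adv := le_mul_of_one_le_left (hnn adv) hk1
    linarith
end

section
/- (Potential-ratio decrease for BdInterp.) Let X be a real normed vector space, γ ≥ 0, Δ ≥ 0, and D > 0. Let s′, s, x̃′, x̃, x′ ∈ X be such that ‖x̃ − s‖ ≤ D, x̃′ ≠ s′, and x′ = ν·x̃′ + (1 − ν)·s′ where ν = ‖x′ − s′‖/‖x̃′ − s′‖ ∈ [0, 1]. Define y = ν·x̃ + (1 − ν)·s and x = s + ρ(y − s; max(‖y − s‖ − γ·Δ, 0)), and suppose x ≠ s. Then x̃ ≠ s and ‖x − s‖/‖x̃ − s‖ ≤ ‖x′ − s′‖/‖x̃′ − s′‖ − γ·Δ/D. -/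
theorem norm_radial_le {X : Type*} [NormedAddCommGroup X] [NormedSpace ℝ X]
    (v : X) {r : ℝ} (hr : 0 ≤ r) : ‖radial v r‖ ≤ r := by
  unfold radial
  split_ifs with h
  · exact h
  · have hv : 0 < ‖v‖ := hr.trans_lt (not_le.mp h)
    rw [norm_smul, Real.norm_of_nonneg (div_nonneg hr hv.le), div_mul_cancel₀ _ hv.ne']

/-- **Potential-ratio decrease for BdInterp.**
With `γ ≥ 0`, `Δ ≥ 0`, `D > 0`, `‖adv − s‖ ≤ D`, `adv' ≠ s'`,
`x' = ν·adv' + (1 − ν)·s'` where `ν = ‖x' − s'‖/‖adv' − s'‖ ∈ [0, 1]`,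
`y = ν·adv + (1 − ν)·s`, `x = s + ρ(y − s; max(‖y − s‖ − γΔ, 0))`, and `x ≠ s`,
one has `adv ≠ s` and `‖x − s‖/‖adv − s‖ ≤ ‖x' − s'‖/‖adv' − s'‖ − γΔ/D`. -/
theorem bdinterp_potential_ratio_decrease
    {X : Type*} [NormedAddCommGroup X] [NormedSpace ℝ X]
    (γ Δ D : ℝ) (hγ : 0 ≤ γ) (hΔ : 0 ≤ Δ) (hD : 0 < D)
    (s' s adv' adv x' : X)
    (hbdd : ‖adv - s‖ ≤ D) (hne : adv' ≠ s')
    (ν : ℝ) (hν : ν = ‖x' - s'‖ / ‖adv' - s'‖) (hν01 : ν ∈ Set.Icc (0 : ℝ) 1)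
    (hx' : x' = ν • adv' + (1 - ν) • s')
    (y x : X)
    (hy : y = ν • adv + (1 - ν) • s)
    (hx : x = s + radial (y - s) (max (‖y - s‖ - γ * Δ) 0))
    (hxs : x ≠ s) :
    adv ≠ s ∧ ‖x - s‖ / ‖adv - s‖ ≤ ‖x' - s'‖ / ‖adv' - s'‖ - γ * Δ / D := by
  have hys : ‖y - s‖ = ν * ‖adv - s‖ := by
    have : y - s = ν • (adv - s) := by rw [hy]; module
    rw [this, norm_smul, Real.norm_of_nonneg hν01.1]
  have hxle : ‖x - s‖ ≤ max (‖y - s‖ - γ * Δ) 0 := by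
    rw [hx, add_sub_cancel_left]
    exact norm_radial_le _ (le_max_right _ _)
  have hγΔ : 0 ≤ γ * Δ := mul_nonneg hγ hΔ
  have hpos : 0 < ‖y - s‖ - γ * Δ := by
    have hlt := (norm_pos_iff.mpr (sub_ne_zero.mpr hxs)).trans_le hxle
    simpa using hlt
  rw [max_eq_left hpos.le, hys] at hxle
  rw [hys] at hpos
  have hadv : adv ≠ s := by
    rintro rfl
    simp at hpos
    linarith
  have ha : 0 < ‖adv - s‖ := norm_pos_iff.mpr (sub_ne_zero.mpr hadv)
  refine ⟨hadv, ?_⟩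
  rw [← hν]
  calc ‖x - s‖ / ‖adv - s‖ ≤ (ν * ‖adv - s‖ - γ * Δ) / ‖adv - s‖ := by gcongr
    _ = ν - γ * Δ / ‖adv - s‖ := by field_simp
    _ ≤ ν - γ * Δ / D := by gcongr
end
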